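/- Let p be a prime such that 𝓑(p) is non-empty, and let β₀ = min 𝓑(p). Then there exist primes q and r with p < q < r such that A(pqr) ≥ p − β₀, and moreover p − β₀ > (p+1)/2; in particular Sister Beiter's conjecture that A(pqr) ≤ (p+1)/2 for all primes p < q < r is false for the prime p. -/

import Mathlib

/-- The inverse of `b` modulo `p`, normalized to lie in `[0, p-1]`. -/
def modInv (p b : ℕ) : ℕ := ((b : ZMod p)⁻¹).val

/-- The set `𝓑₋(p)` of integers `β` with `1 ≤ β ≤ (p-3)/2`, `p ≤ β + 2β̄ + 1` and `β > β̄`. -/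
def Bminus (p : ℕ) : Finset ℕ :=
  (Finset.Icc 1 p).filter fun β =>
    2 * β + 3 ≤ p ∧ p ≤ β + 2 * modInv p β + 1 ∧ modInv p β < β

/-- The set `𝓑₊(p)` of integers `β` with `1 ≤ β ≤ (p-3)/2`, `β + β̄ ≥ p` and `β̄ ≤ 2β`. -/
def Bplus (p : ℕ) : Finset ℕ :=
  (Finset.Icc 1 p).filter fun β =>
    2 * β + 3 ≤ p ∧ p ≤ β + modInv p β ∧ modInv p β ≤ 2 * β

/-- The set `𝓑(p) = 𝓑₋(p) ∪ 𝓑₊(p)`. -/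
def Bset (p : ℕ) : Finset ℕ := Bminus p ∪ Bplus p

/-- The height `A(n)` of the `n`-th cyclotomic polynomial. -/
noncomputable def cycHeight (n : ℕ) : ℕ :=
  (Finset.range ((Polynomial.cyclotomic n ℤ).natDegree + 1)).sup
    fun k => ((Polynomial.cyclotomic n ℤ).coeff k).natAbs

open Polynomial in
/-- The linear functional sending `f` to the coefficient of `X ^ n` in the power series
`f / (1 - X ^ N)`. -/
noncomputable def divCoeff (N n : ℕ) : ℤ[X] →ₗ[ℤ] ℤ :=
  ∑ l ∈ Finset.range (n + 1), if l * N ≤ n then Polynomial.lcoeff ℤ (n - l * N) else 0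

open Polynomial in
theorem divCoeff_mul_one_sub {N : ℕ} (hN : 0 < N) (n : ℕ) (f : ℤ[X]) :
    divCoeff N n (f * (1 - X ^ N)) = f.coeff n := by
  have key : ∀ l ∈ Finset.range (n + 1),
      (if l * N ≤ n then Polynomial.lcoeff ℤ (n - l * N) else 0) (f * (1 - X ^ N)) =
        (if l * N ≤ n then f.coeff (n - l * N) else 0) -
          (if (l + 1) * N ≤ n then f.coeff (n - (l + 1) * N) else 0) := by
    intro l _
    have e : (l + 1) * N = l * N + N := by ring
    by_cases h : l * N ≤ n
    · rw [if_pos h, if_pos h, Polynomial.lcoeff_apply, mul_sub, mul_one, coeff_sub,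
        coeff_mul_X_pow', e]
      congr 1
      by_cases h' : l * N + N ≤ n
      · rw [if_pos h', if_pos (by omega), Nat.sub_sub]
      · rw [if_neg h', if_neg (by omega)]
    · rw [if_neg h, if_neg h, if_neg (by omega)]
      simp
  rw [divCoeff, LinearMap.sum_apply, Finset.sum_congr rfl key, Finset.sum_range_sub']
  have : n < (n + 1) * N := by nlinarith
  simp [this]

open Polynomial in
theorem divCoeff_X_pow {N : ℕ} (hN : 0 < N) (n e : ℕ) :
    divCoeff N n (X ^ e) = if e ≤ n ∧ e ≡ n [MOD N] then 1 else 0 := by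
  rw [divCoeff, LinearMap.sum_apply]
  split_ifs with h
  · obtain ⟨l, hl⟩ := (Nat.modEq_iff_dvd' h.1).1 h.2
    have hl' : l * N = n - e := by rw [hl, mul_comm]
    have hln : l ≤ l * N := Nat.le_mul_of_pos_right l hN
    rw [Finset.sum_eq_single_of_mem l (Finset.mem_range.2 (by omega))]
    · rw [if_pos (by omega), lcoeff_apply, coeff_X_pow, if_pos (by omega)]
    · intro b _ hb
      split_ifs with hbn
      · rw [lcoeff_apply, coeff_X_pow, if_neg]
        intro hbe
        exact hb (Nat.eq_of_mul_eq_mul_right hN (by omega))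
      · rfl
  · refine Finset.sum_eq_zero fun l _ => ?_
    split_ifs with hl
    · rw [lcoeff_apply, coeff_X_pow, if_neg]
      intro hle
      refine h ⟨by omega, ?_⟩
      rw [Nat.modEq_iff_dvd' (by omega)]
      exact ⟨l, by rw [mul_comm]; omega⟩
    · rfl

open Polynomial in
theorem cyclotomic_prime_mul_prime_mul {p q : ℕ} (hp : p.Prime) (hq : q.Prime) (hpq : p ≠ q) :
    cyclotomic (p * q) ℤ * ((X ^ p - 1) * (X ^ q - 1)) = (X - 1) * (X ^ (p * q) - 1) := by
  have h1 := cyclotomic_expand_eq_cyclotomic_mul hq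
    (fun h => hpq ((Nat.prime_dvd_prime_iff_eq hq hp).1 h).symm) ℤ
  have := Fact.mk hp
  have h2 := cyclotomic_prime_mul_X_sub_one ℤ p
  have h3 := congrArg (expand ℤ q) h2
  simp only [map_mul, map_sub, expand_X, map_one, map_pow] at h3
  rw [h1, ← pow_mul, mul_comm q p] at h3
  rw [← h3, ← h2]
  ring

open Polynomial in
/-- The explicit form of the binary cyclotomic polynomial `Φ_{pq}`. -/
theorem cyclotomic_prime_mul_prime_eq {p q R τ : ℕ} (hp : p.Prime) (hq : q.Prime) (hpq : p ≠ q)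
    (h : p * R + q * τ = p * q + 1) (hR : R ≤ q) (hτ : τ ≤ p) :
    cyclotomic (p * q) ℤ =
      (∑ i ∈ Finset.range R, ∑ j ∈ Finset.range τ, X ^ (p * i + q * j)) -
      ∑ i ∈ Finset.range (q - R), ∑ j ∈ Finset.range (p - τ), X ^ (1 + p * i + q * j) := by
  have hne : ∀ k : ℕ, 0 < k → (X ^ k - 1 : ℤ[X]) ≠ 0 := fun k hk => X_pow_sub_C_ne_zero hk 1
  refine mul_right_cancel₀ (mul_ne_zero (hne p hp.pos) (hne q hq.pos)) ?_
  rw [cyclotomic_prime_mul_prime_mul hp hq hpq]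
  have e1 : (∑ i ∈ Finset.range R, ∑ j ∈ Finset.range τ, (X : ℤ[X]) ^ (p * i + q * j)) =
      (∑ i ∈ Finset.range R, (X ^ p) ^ i) * ∑ j ∈ Finset.range τ, (X ^ q) ^ j := by
    simp only [Finset.sum_mul_sum, pow_add, pow_mul]
  have e2 : (∑ i ∈ Finset.range (q - R), ∑ j ∈ Finset.range (p - τ),
        (X : ℤ[X]) ^ (1 + p * i + q * j)) =
      X * ((∑ i ∈ Finset.range (q - R), (X ^ p) ^ i) *
        ∑ j ∈ Finset.range (p - τ), (X ^ q) ^ j) := by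
    rw [Finset.sum_mul_sum]
    simp only [pow_add, pow_mul, Finset.mul_sum, pow_one, mul_assoc]
  obtain ⟨a, rfl⟩ := Nat.exists_eq_add_of_le hR
  obtain ⟨b, rfl⟩ := Nat.exists_eq_add_of_le hτ
  rw [e1, e2, Nat.add_sub_cancel_left, Nat.add_sub_cancel_left]
  set P := τ + b with hP
  set Q := R + a with hQ
  clear_value P Q
  have g1 := geom_sum_mul ((X : ℤ[X]) ^ P) R
  have g2 := geom_sum_mul ((X : ℤ[X]) ^ Q) τ
  have g3 := geom_sum_mul ((X : ℤ[X]) ^ P) a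
  have g4 := geom_sum_mul ((X : ℤ[X]) ^ Q) b
  have k1 : (X : ℤ[X]) * (X ^ P) ^ a = (X ^ Q) ^ τ := by
    rw [← pow_mul, ← pow_mul, ← pow_succ']
    congr 1
    have : P * Q = P * R + P * a := by rw [hQ]; ring
    omega
  have k2 : (X : ℤ[X]) * (X ^ Q) ^ b = (X ^ P) ^ R := by
    rw [← pow_mul, ← pow_mul, ← pow_succ']
    congr 1
    have : P * Q = Q * τ + Q * b := by rw [hP]; ring
    omega
  have k3 : (X : ℤ[X]) * X ^ (P * Q) = (X ^ P) ^ R * (X ^ Q) ^ τ := by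
    rw [← pow_mul, ← pow_mul, ← pow_succ', ← pow_add, h]
  have k4 : (X : ℤ[X]) ^ (P * Q) = (X ^ P) ^ a * (X ^ P) ^ R := by
    rw [← pow_mul, ← pow_mul, ← pow_add]
    congr 1
    rw [hQ]; ring
  calc _ = ((X ^ P) ^ R - 1) * ((X ^ Q) ^ τ - 1) -
        X * (((X : ℤ[X]) ^ P) ^ a - 1) * ((X ^ Q) ^ b - 1) := by
        linear_combination k3 - k4 + ((X : ℤ[X]) ^ P) ^ a * k2 - k2 - k1
    _ = _ := by
        rw [← g1, ← g2, ← g3, ← g4]; ring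

/-- The contribution of the pair `(i, j)`, standing for the residue `p * i + q * j` modulo
`p * q`, to the part of `Φ_{pq}` of degree at most `T`. -/
def truncCoeff (p q R τ T i j : ℕ) : ℤ :=
  if i < R ∧ j < τ then (if p * i + q * j ≤ T then 1 else 0)
  else if R ≤ i ∧ τ ≤ j then (if p * i + q * j ≤ T + p * q then -1 else 0)
  else 0

theorem sum_sum_ite_eq_pair (a b x y : ℕ) (c : Prop) [Decidable c] :
    (∑ i ∈ Finset.range a, ∑ j ∈ Finset.range b, if (i = x ∧ j = y) ∧ c then (1 : ℤ) else 0) =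
      if (x < a ∧ y < b) ∧ c then 1 else 0 := by
  by_cases hc : c
  · simp only [hc, and_true]
    have : ∀ i j : ℕ, (if i = x ∧ j = y then (1 : ℤ) else 0) =
        (if i = x then 1 else 0) * (if j = y then 1 else 0) := by
      intro i j; split_ifs <;> simp_all
    simp only [this, ← Finset.sum_mul_sum, Finset.sum_ite_eq', Finset.mem_range]
    split_ifs <;> simp_all
  · simp [hc]

theorem mul_add_mul_modEq_iff {p q i j x y : ℕ} (hpq : p.Coprime q) (hi : i < q) (hj : j < p)
    (hx : x < q) (hy : y < p) :
    p * i + q * j ≡ p * x + q * y [MOD p * q] ↔ i = x ∧ j = y := by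
  refine ⟨fun h => ?_, fun h => by rw [h.1, h.2]⟩
  have h1 : p * i ≡ p * x [MOD q] := by
    have := h.of_mul_left p
    simpa [Nat.ModEq, Nat.add_mod] using this
  have h2 : q * j ≡ q * y [MOD p] := by
    have := h.of_mul_right q
    simpa [Nat.ModEq, Nat.add_mod] using this
  exact ⟨((Nat.ModEq.cancel_left_of_coprime (by simpa using hpq.symm) h1).eq_of_lt_of_lt hi hx),
    ((Nat.ModEq.cancel_left_of_coprime (by simpa using hpq) h2).eq_of_lt_of_lt hj hy)⟩

open Polynomial in
theorem divCoeff_expand_cyclotomic_mul_X_pow {p q r R τ T n e x y : ℕ}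
    (hp : p.Prime) (hq : q.Prime) (hpq : p ≠ q) (hr : r.Coprime (p * q))
    (h : p * R + q * τ = p * q + 1) (hR : R ≤ q) (hτ : τ ≤ p)
    (hn : T * r + e ≤ n) (hn' : n < (T + 1) * r) (hx : x < q) (hy : y < p)
    (hxy : r * (p * x + q * y) + e ≡ n [MOD p * q]) :
    divCoeff (p * q) n (expand ℤ r (cyclotomic (p * q) ℤ) * X ^ e) =
      truncCoeff p q R τ T x y := by
  have hN : 0 < p * q := Nat.mul_pos hp.pos hq.pos
  have hcop : p.Coprime q := (Nat.coprime_primes hp hq).2 hpq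
  have hle : ∀ v : ℕ, r * v + e ≤ n ↔ v ≤ T := by
    intro v
    constructor
    · intro hv
      by_contra hvT
      have : (T + 1) * r ≤ v * r := Nat.mul_le_mul_right r (by omega)
      rw [mul_comm r v] at hv
      omega
    · intro hv
      have : v * r ≤ T * r := Nat.mul_le_mul_right r hv
      rw [mul_comm r v]
      omega
  have hmod : ∀ v : ℕ, r * v + e ≡ n [MOD p * q] ↔ v ≡ p * x + q * y [MOD p * q] := by
    intro v
    constructor
    · intro hv
      exact Nat.ModEq.cancel_left_of_coprime (by simpa using hr.symm)
        (Nat.ModEq.add_right_cancel' e (hv.trans hxy.symm))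
    · intro hv
      exact ((hv.mul_left r).add_right e).trans hxy
  rw [cyclotomic_prime_mul_prime_eq hp hq hpq h hR hτ]
  simp only [map_sub, map_sum, map_pow, expand_X, sub_mul, Finset.sum_mul, ← pow_mul, ← pow_add,
    divCoeff_X_pow hN, hle, hmod]
  have s1 : ∀ i ∈ Finset.range R, ∀ j ∈ Finset.range τ,
      (if p * i + q * j ≤ T ∧ p * i + q * j ≡ p * x + q * y [MOD p * q] then (1 : ℤ) else 0) =
        if (i = x ∧ j = y) ∧ p * x + q * y ≤ T then 1 else 0 := by
    intro i hi j hj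
    rw [Finset.mem_range] at hi hj
    refine if_congr ?_ rfl rfl
    rw [mul_add_mul_modEq_iff hcop (by omega) (by omega) hx hy]
    constructor
    · rintro ⟨h1, rfl, rfl⟩; exact ⟨⟨rfl, rfl⟩, h1⟩
    · rintro ⟨⟨rfl, rfl⟩, h1⟩; exact ⟨h1, rfl, rfl⟩
  have s2 : ∀ i ∈ Finset.range (q - R), ∀ j ∈ Finset.range (p - τ),
      (if 1 + p * i + q * j ≤ T ∧ 1 + p * i + q * j ≡ p * x + q * y [MOD p * q]
        then (1 : ℤ) else 0) =
        if (i = x - R ∧ j = y - τ) ∧ (R ≤ x ∧ τ ≤ y ∧ p * x + q * y ≤ T + p * q)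
          then 1 else 0 := by
    intro i hi j hj
    rw [Finset.mem_range] at hi hj
    have e1 : p * (i + R) + q * (j + τ) = 1 + p * i + q * j + p * q := by linarith
    have e2 : (1 + p * i + q * j ≡ p * x + q * y [MOD p * q]) ↔ i + R = x ∧ j + τ = y := by
      rw [← mul_add_mul_modEq_iff hcop (i := i + R) (j := j + τ) (by omega) (by omega) hx hy, e1]
      simp [Nat.ModEq]
    refine if_congr ?_ rfl rfl
    rw [e2]
    constructor
    · rintro ⟨h1, rfl, rfl⟩
      exact ⟨⟨by omega, by omega⟩, by omega, by omega, by omega⟩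
    · rintro ⟨⟨h1, h2⟩, h3, h4, h5⟩
      obtain rfl : x = i + R := by omega
      obtain rfl : y = j + τ := by omega
      exact ⟨by omega, rfl, rfl⟩
  rw [Finset.sum_congr rfl fun i hi => Finset.sum_congr rfl (s1 i hi),
    Finset.sum_congr rfl fun i hi => Finset.sum_congr rfl (s2 i hi),
    sum_sum_ite_eq_pair, sum_sum_ite_eq_pair, truncCoeff]
  split_ifs <;> omega

open Polynomial in
/-- A form of Kaplan's lemma for the coefficients of a ternary cyclotomic polynomial. -/
theorem coeff_cyclotomic_three_primes {p q r R τ T n : ℕ} {x₁ y₁ x₂ y₂ : ℕ → ℕ}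
    (hp : p.Prime) (hq : q.Prime) (hr : r.Prime) (hpq : p < q) (hqr : q < r)
    (h : p * R + q * τ = p * q + 1) (hR : R ≤ q) (hτ : τ ≤ p)
    (hn : T * r + p + q ≤ n) (hn' : n < (T + 1) * r)
    (hx₁ : ∀ m < p, x₁ m < q) (hy₁ : ∀ m < p, y₁ m < p)
    (hx₂ : ∀ m < p, x₂ m < q) (hy₂ : ∀ m < p, y₂ m < p)
    (h₁ : ∀ m < p, r * (p * x₁ m + q * y₁ m) + m ≡ n [MOD p * q])
    (h₂ : ∀ m < p, r * (p * x₂ m + q * y₂ m) + (m + q) ≡ n [MOD p * q]) :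
    (cyclotomic (p * q * r) ℤ).coeff n =
      ∑ m ∈ Finset.range p,
        (truncCoeff p q R τ T (x₁ m) (y₁ m) - truncCoeff p q R τ T (x₂ m) (y₂ m)) := by
  have hrp : r.Coprime p := (Nat.coprime_primes hr hp).2 (by omega)
  have hrq : r.Coprime q := (Nat.coprime_primes hr hq).2 (by omega)
  have hcop : r.Coprime (p * q) := hrp.mul_right hrq
  have hdvd : ¬ r ∣ p * q := (Nat.Prime.coprime_iff_not_dvd hr).1 hcop
  have hN : 0 < p * q := Nat.mul_pos hp.pos hq.pos
  have e1 := cyclotomic_expand_eq_cyclotomic_mul hr hdvd ℤ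
  have e2 := cyclotomic_prime_mul_prime_mul hp hq hpq.ne
  have e3 : cyclotomic (p * q * r) ℤ * (1 - X ^ (p * q)) =
      ∑ m ∈ Finset.range p, (expand ℤ r (cyclotomic (p * q) ℤ) * X ^ m -
        expand ℤ r (cyclotomic (p * q) ℤ) * X ^ (m + q)) := by
    refine mul_right_cancel₀ (X_sub_C_ne_zero (1 : ℤ)) ?_
    have g := geom_sum_mul (X : ℤ[X]) p
    have e4 : ∑ m ∈ Finset.range p, (expand ℤ r (cyclotomic (p * q) ℤ) * X ^ m -
        expand ℤ r (cyclotomic (p * q) ℤ) * X ^ (m + q)) =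
        expand ℤ r (cyclotomic (p * q) ℤ) * (1 - X ^ q) * ∑ m ∈ Finset.range p, X ^ m := by
      rw [Finset.mul_sum]
      exact Finset.sum_congr rfl fun m _ => by ring
    rw [e4, e1, map_one]
    linear_combination cyclotomic (p * q * r) ℤ * e2 -
      cyclotomic (p * q * r) ℤ * cyclotomic (p * q) ℤ * (1 - X ^ q) * g
  rw [← divCoeff_mul_one_sub hN n, e3, map_sum]
  refine Finset.sum_congr rfl fun m hm => ?_
  rw [Finset.mem_range] at hm
  rw [map_sub, divCoeff_expand_cyclotomic_mul_X_pow hp hq hpq.ne hcop h hR hτ (by omega) hn'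
      (hx₁ m hm) (hy₁ m hm) (h₁ m hm),
    divCoeff_expand_cyclotomic_mul_X_pow hp hq hpq.ne hcop h hR hτ (by omega) hn'
      (hx₂ m hm) (hy₂ m hm) (h₂ m hm)]

theorem exists_prime_modEq_threshold {p q k : ℕ} (hp : p.Prime) (hq : q.Prime) (hpq : p < q)
    (hk : 0 < k) (hkq : k < q) (T : ℕ) (c : ℤ) :
    ∃ r n : ℕ, r.Prime ∧ q < r ∧ T * r + p + q ≤ n ∧ n < (T + 1) * r ∧
      ∀ v e : ℕ, (v + (q - k * p) * e : ℤ) ≡ c [ZMOD (p * q : ℕ)] →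
        r * v + e ≡ n [MOD p * q] := by
  have hN : 0 < p * q := Nat.mul_pos hp.pos hq.pos
  have : NeZero (p * q) := ⟨hN.ne'⟩
  have hcop : IsCoprime (p : ℤ) (q : ℤ) :=
    Nat.isCoprime_iff_coprime.2 ((Nat.coprime_primes hp hq).2 hpq.ne)
  have hkc : IsCoprime (k : ℤ) (q : ℤ) :=
    Nat.isCoprime_iff_coprime.2 (Nat.coprime_of_lt_prime hk.ne' hkq hq).symm
  have hu : IsCoprime ((q : ℤ) - k * p) ((p * q : ℕ) : ℤ) := by
    push_cast
    refine IsCoprime.mul_right ?_ ?_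
    · have := hcop.symm.add_mul_right_left (-(k : ℤ))
      rwa [neg_mul, ← sub_eq_add_neg] at this
    · have := ((hkc.mul_left hcop).neg_left).add_mul_right_left 1
      rwa [one_mul, neg_add_eq_sub] at this
  obtain ⟨w, hw⟩ := (ZMod.coe_int_isUnit_iff_isCoprime _ _).2 hu.symm
  obtain ⟨r, hr, hrp, hrw⟩ := Nat.forall_exists_prime_gt_and_eq_mod (w⁻¹).isUnit (p * q + p + q)
  set a : ℕ := ((r : ZMod (p * q)) * c - (T * r + p + q : ℕ)).val with ha
  have ha' : a < p * q := ZMod.val_lt _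
  refine ⟨r, T * r + p + q + a, hrp, by omega, by omega, by rw [add_mul]; omega, ?_⟩
  intro v e hve
  rw [← ZMod.natCast_eq_natCast_iff]
  have h1 := (ZMod.intCast_eq_intCast_iff _ _ _).2 hve
  push_cast at h1 hw
  have h2 : (r : ZMod (p * q)) * (q - k * p) = 1 := by
    rw [hrw, ← hw, Units.inv_mul]
  rw [Nat.cast_add _ a, ha, ZMod.natCast_zmod_val]
  push_cast
  linear_combination (r : ZMod (p * q)) * h1 - (e : ZMod (p * q)) * h2

section truncCoeff

variable {p q R τ T i j : ℕ}

theorem truncCoeff_eq_one (hi : i < R) (hj : j < τ) (h : p * i + q * j ≤ T) :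
    truncCoeff p q R τ T i j = 1 := by
  rw [truncCoeff, if_pos ⟨hi, hj⟩, if_pos h]

theorem truncCoeff_eq_neg_one (hi : R ≤ i) (hj : τ ≤ j) (h : p * i + q * j ≤ T + p * q) :
    truncCoeff p q R τ T i j = -1 := by
  rw [truncCoeff, if_neg (by omega), if_pos ⟨hi, hj⟩, if_pos h]

theorem truncCoeff_le_one : truncCoeff p q R τ T i j ≤ 1 := by
  unfold truncCoeff; split_ifs <;> norm_num

theorem truncCoeff_nonpos_of_le_left (hi : R ≤ i) : truncCoeff p q R τ T i j ≤ 0 := by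
  unfold truncCoeff; split_ifs <;> omega

theorem truncCoeff_nonpos_of_le_right (hj : τ ≤ j) : truncCoeff p q R τ T i j ≤ 0 := by
  unfold truncCoeff; split_ifs <;> omega

theorem truncCoeff_nonpos_of_lt (h : T < p * i + q * j) : truncCoeff p q R τ T i j ≤ 0 := by
  unfold truncCoeff; split_ifs <;> omega

theorem truncCoeff_nonneg_of_lt (h : T + p * q < p * i + q * j) :
    0 ≤ truncCoeff p q R τ T i j := by
  unfold truncCoeff; split_ifs <;> omega

end truncCoeff

/-- The sequence `k * (m - s)` reduced modulo `q`, in the range where it wraps around once. -/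
def wrapSeq (q k s m : ℕ) : ℕ := if m < s then q - k * (s - m) else k * (m - s)

theorem wrapSeq_of_lt {q k s m : ℕ} (h : m < s) : wrapSeq q k s m = q - k * (s - m) := if_pos h

theorem wrapSeq_of_le {q k s m : ℕ} (h : s ≤ m) : wrapSeq q k s m = k * (m - s) :=
  if_neg (by omega)

theorem mul_sub_lt_of_mul_lt {p q k a m : ℕ} (hkp : k * p < q) (h : a ≤ p) :
    k * (a - m) < q :=
  (Nat.mul_le_mul_left k (by omega)).trans_lt hkp

theorem exists_coeff_eq_sum_truncCoeff {p q R τ T k s : ℕ} {b : ℤ} {y₁ y₂ : ℕ → ℕ}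
    (hp : p.Prime) (hq : q.Prime) (hpq : p < q)
    (h : p * R + q * τ = p * q + 1) (hR : R ≤ q) (hτ : τ ≤ p)
    (hk : 0 < k) (hkp : k * p < q) (hs : s ≤ p)
    (hy₁ : ∀ m < p, y₁ m < p) (hy₂ : ∀ m < p, y₂ m < p)
    (h₁ : ∀ m < p, (y₁ m + m : ℤ) ≡ b [ZMOD p])
    (h₂ : ∀ m < p, (y₂ m + m + q : ℤ) ≡ b [ZMOD p]) :
    ∃ r n : ℕ, r.Prime ∧ q < r ∧ (Polynomial.cyclotomic (p * q * r) ℤ).coeff n =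
      ∑ m ∈ Finset.range p, (truncCoeff p q R τ T (wrapSeq q k s m) (y₁ m) -
        truncCoeff p q R τ T (wrapSeq q k s m) (y₂ m)) := by
  have hkq : k < q := (Nat.le_mul_of_pos_right k hp.pos).trans_lt hkp
  obtain ⟨r, n, hr, hqr, hn, hn', hv⟩ :=
    exists_prime_modEq_threshold hp hq hpq hk hkq T (q * b - k * p * s)
  have hx : ∀ m < p, wrapSeq q k s m < q := by
    intro m hm
    rcases lt_or_ge m s with hms | hms
    · rw [wrapSeq_of_lt hms]
      have : 0 < k * (s - m) := Nat.mul_pos hk (by omega)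
      omega
    · rw [wrapSeq_of_le hms]
      exact mul_sub_lt_of_mul_lt hkp hm.le
  have hwrap : ∀ m < p, ∃ z : ℤ, (wrapSeq q k s m : ℤ) = k * (m - s) + q * z := by
    intro m hm
    rcases lt_or_ge m s with hms | hms
    · refine ⟨1, ?_⟩
      rw [wrapSeq_of_lt hms, Nat.cast_sub (mul_sub_lt_of_mul_lt hkp hs).le, Nat.cast_mul,
        Nat.cast_sub hms.le]
      ring
    · refine ⟨0, ?_⟩
      rw [wrapSeq_of_le hms, Nat.cast_mul, Nat.cast_sub hms]
      ring
  refine ⟨r, n, hr, hqr, coeff_cyclotomic_three_primes hp hq hr hpq hqr h hR hτ hn hn'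
    hx hy₁ hx hy₂ (fun m hm => hv _ _ ?_) (fun m hm => hv _ _ ?_)⟩
  · obtain ⟨z, hz⟩ := hwrap m hm
    obtain ⟨z', hz'⟩ := (h₁ m hm).symm.dvd
    refine (Int.modEq_iff_dvd.2 ⟨z + z', ?_⟩).symm
    push_cast
    rw [hz]
    linear_combination (q : ℤ) * hz'
  · obtain ⟨z, hz⟩ := hwrap m hm
    obtain ⟨z', hz'⟩ := (h₂ m hm).symm.dvd
    refine (Int.modEq_iff_dvd.2 ⟨z + z' - k, ?_⟩).symm
    push_cast
    rw [hz]
    linear_combination (q : ℤ) * hz'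

theorem sum_range_ite_mem_Ico {a b p : ℕ} (hab : a ≤ b) (hb : b ≤ p) :
    ∑ m ∈ Finset.range p, (if a ≤ m ∧ m < b then (1 : ℤ) else 0) = b - a := by
  rw [← Finset.sum_filter, Finset.sum_const, nsmul_one]
  have : (Finset.range p).filter (fun m => a ≤ m ∧ m < b) = Finset.Ico a b := by
    ext m; simp; omega
  rw [this, Nat.card_Ico, Nat.cast_sub hab]

theorem exists_le_coeff_of_lt {p q R τ U k t : ℕ}
    (hp : p.Prime) (hq : q.Prime) (hpq : p < q)
    (h : p * R + q * τ = p * q + 1) (hR : R ≤ q)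
    (hU : U < τ) (hτ : 2 * τ < p) (hUτ : p ≤ U + 2 * τ) (hqU : q ≡ U [MOD p])
    (hk : 0 < k) (hk₁ : k * p * (p - τ) < q * τ) (hk₂ : q * τ ≤ k * p * (p - τ) + t)
    (hkt : k * p + t < q) :
    ∃ r n : ℕ, r.Prime ∧ q < r ∧
      (p - τ : ℤ) ≤ (Polynomial.cyclotomic (p * q * r) ℤ).coeff n := by
  obtain ⟨r, n, hr, hqr, hc⟩ := exists_coeff_eq_sum_truncCoeff (T := (τ - 1) * q + t)
    (s := p - τ) (b := p - 1) (y₁ := fun m => p - 1 - m)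
    (y₂ := fun m => if m < p - U then p - 1 - U - m else 2 * p - 1 - U - m)
    hp hq hpq h hR (by omega) hk (by omega) (by omega)
    (fun m hm => by omega) (fun m hm => by split_ifs <;> omega)
    (fun m hm => by
      have : ((p - 1 - m : ℕ) : ℤ) + m = p - 1 := by omega
      rw [this])
    (fun m hm => by
      have hqU' := (Int.natCast_modEq_iff.2 hqU)
      refine (hqU'.add_left _).trans ?_
      split_ifs with hmU
      · have : ((p - 1 - U - m : ℕ) : ℤ) + m + U = p - 1 := by omega
        rw [this]
      · have : ((2 * p - 1 - U - m : ℕ) : ℤ) + m + U = p - 1 + p := by omega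
        rw [this]
        exact Int.add_modEq_right)
  refine ⟨r, n, hr, hqr, ?_⟩
  rw [hc]
  have hpτ : ((p - τ : ℕ) : ℤ) = p - τ := by omega
  have hpτU : ((p - τ - U : ℕ) : ℤ) = p - τ - U := by omega
  have hpU : ((p - U : ℕ) : ℤ) = p - U := by omega
  have hsum : (p - τ : ℤ) = ∑ m ∈ Finset.range p,
      ((if p - τ ≤ m ∧ m < p then (1 : ℤ) else 0) + (if 0 ≤ m ∧ m < p - τ - U then 1 else 0) -
        (if p - τ ≤ m ∧ m < p - U then 1 else 0)) := by
    rw [Finset.sum_sub_distrib, Finset.sum_add_distrib, sum_range_ite_mem_Ico (by omega) le_rfl,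
      sum_range_ite_mem_Ico (by omega) (by omega), sum_range_ite_mem_Ico (by omega) (by omega),
      hpτ, hpτU, hpU]
    push_cast
    ring
  rw [hsum]
  refine Finset.sum_le_sum fun m hm => ?_
  rw [Finset.mem_range] at hm
  rcases lt_or_ge m (p - τ) with hms | hms
  · obtain ⟨d, hd⟩ := Nat.exists_eq_add_of_lt hms
    have hdm : p - τ - m = d + 1 := by omega
    rw [wrapSeq_of_lt hms, hdm]
    have hkd : k * (d + 1) ≤ q := by nlinarith
    have hxR : R ≤ q - k * (d + 1) := by
      refine Nat.le_of_mul_le_mul_left ?_ hp.pos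
      have e1 : p * (k * (d + 1)) ≤ k * p * (p - τ) := by
        rw [← mul_assoc, mul_comm p k]
        exact Nat.mul_le_mul_left _ (by omega)
      have e2 : q * (p - τ) + q * τ = p * q := by
        rw [← mul_add, Nat.sub_add_cancel (by omega), mul_comm]
      rw [Nat.mul_sub]
      omega
    have t₁ : 0 ≤ truncCoeff p q R τ ((τ - 1) * q + t) (q - k * (d + 1)) (p - 1 - m) := by
      refine truncCoeff_nonneg_of_lt ?_
      obtain ⟨w, rfl⟩ : ∃ w, τ = w + 1 := ⟨τ - 1, by omega⟩
      have : p - 1 - m = w + (d + 1) := by omega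
      rw [this]
      zify [hkd]
      zify at hkt
      have : (0 : ℤ) ≤ d * (q - k * p) := mul_nonneg (by positivity) (by omega)
      push_cast
      ring_nf at this ⊢
      linarith
    have t₂ : truncCoeff p q R τ ((τ - 1) * q + t) (q - k * (d + 1))
        (if m < p - U then p - 1 - U - m else 2 * p - 1 - U - m) ≤
        -(if 0 ≤ m ∧ m < p - τ - U then 1 else 0) := by
      split_ifs with h1 h2
      · refine (truncCoeff_eq_neg_one hxR (by omega) ?_).le
        obtain ⟨g, hg⟩ : ∃ g, p - 1 - U - m = g := ⟨_, rfl⟩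
        have hgm : g + m + 1 ≤ 2 * τ := by omega
        have e1 : q * (g + m + 1) ≤ q * (2 * τ) := Nat.mul_le_mul_left q hgm
        have e2 : k * p * m ≤ q * m := Nat.mul_le_mul_right m (by omega)
        have e3 : (τ - 1) * q + q = q * τ := by
          rw [← Nat.succ_mul, Nat.succ_eq_add_one, Nat.sub_add_cancel (by omega), mul_comm]
        have e4 : p - τ = d + 1 + m := by omega
        rw [hg]
        rw [e4] at hk₂
        zify [hkd] at *
        linarith
      all_goals first | omega | exact truncCoeff_nonpos_of_le_left hxR
    rw [if_neg (by omega), if_neg (by omega : ¬ (p - τ ≤ m ∧ m < p - U))]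
    linarith
  · rw [wrapSeq_of_le hms]
    obtain ⟨d, hd⟩ := Nat.exists_eq_add_of_le hms
    have hdm : m - (p - τ) = d := by omega
    rw [hdm]
    have t₁ : truncCoeff p q R τ ((τ - 1) * q + t) (k * d) (p - 1 - m) = 1 := by
      refine truncCoeff_eq_one ?_ (by omega) ?_
      · refine Nat.lt_of_mul_lt_mul_left (a := p) ?_
        have e1 : k * p * d ≤ q * d := Nat.mul_le_mul_right d (by omega)
        have e2 : q * d + q * τ ≤ q * p := by
          rw [← mul_add]
          exact Nat.mul_le_mul_left q (by omega)
        linarith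
      · obtain ⟨w, hw⟩ := Nat.exists_eq_add_of_lt (show d < τ by omega)
        have e1 : k * p * d ≤ q * d := Nat.mul_le_mul_right d (by omega)
        have e2 : p - 1 - m = w := by omega
        have e3 : τ - 1 = d + w := by omega
        rw [e2, e3]
        linarith
    have t₂ : truncCoeff p q R τ ((τ - 1) * q + t) (k * d)
        (if m < p - U then p - 1 - U - m else 2 * p - 1 - U - m) ≤
        (if p - τ ≤ m ∧ m < p - U then 1 else 0) := by
      split_ifs with h1 h2
      · exact truncCoeff_le_one
      all_goals first | omega | exact truncCoeff_nonpos_of_le_right (by omega)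
    rw [if_pos ⟨hms, hm⟩, if_neg (by omega : ¬ (0 ≤ m ∧ m < p - τ - U)), t₁]
    linarith

theorem exists_coeff_le_of_le_add {p q R τ U k : ℕ}
    (hp : p.Prime) (hq : q.Prime) (hpq : p < q)
    (h : p * R + q * τ = p * q + 1) (hR : R ≤ q)
    (hU : 2 * U + 3 ≤ p) (hτ : τ ≤ p) (hUτ : p ≤ U + τ) (hqU : q ≡ U [MOD p])
    (hk : 0 < k) (hk₁ : k * p * (p - 1 - U) ≤ q * (p - τ))
    (hk₂ : q * (p - 1 - 2 * U) < k * p * (p - 1 - U)) (hkp : k * p < q) :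
    ∃ r n : ℕ, r.Prime ∧ q < r ∧
      (Polynomial.cyclotomic (p * q * r) ℤ).coeff n ≤ -(p - U : ℤ) := by
  obtain ⟨r, n, hr, hqr, hc⟩ := exists_coeff_eq_sum_truncCoeff (T := (p - 1 - U) * q)
    (s := U) (b := U - 1) (y₁ := fun m => if m < U then U - 1 - m else p - 1 + U - m)
    (y₂ := fun m => p - 1 - m)
    hp hq hpq h hR hτ hk hkp (by omega)
    (fun m hm => by split_ifs <;> omega) (fun m hm => by omega)
    (fun m hm => by
      split_ifs with hmU
      · have : ((U - 1 - m : ℕ) : ℤ) + m = U - 1 := by omega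
        rw [this]
      · have : ((p - 1 + U - m : ℕ) : ℤ) + m = U - 1 + p := by omega
        rw [this]
        exact Int.add_modEq_right)
    (fun m hm => by
      have hqU' := (Int.natCast_modEq_iff.2 hqU)
      refine (hqU'.add_left _).trans ?_
      have : ((p - 1 - m : ℕ) : ℤ) + m + U = U - 1 + p := by omega
      rw [this]
      exact Int.add_modEq_right)
  refine ⟨r, n, hr, hqr, ?_⟩
  rw [hc]
  have hsum : (p - U : ℤ) = ∑ m ∈ Finset.range p, (if U ≤ m ∧ m < p then (1 : ℤ) else 0) := by
    rw [sum_range_ite_mem_Ico (by omega) le_rfl]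
  rw [hsum, ← Finset.sum_neg_distrib]
  refine Finset.sum_le_sum fun m hm => ?_
  rw [Finset.mem_range] at hm
  rcases lt_or_ge m U with hms | hms
  · obtain ⟨d, rfl⟩ := Nat.exists_eq_add_of_lt hms
    have hdm : m + d + 1 - m = d + 1 := by omega
    rw [wrapSeq_of_lt hms, hdm, if_neg (by omega : ¬ (m + d + 1 ≤ m ∧ m < p))]
    have hkd : k * (d + 1) ≤ q := by nlinarith
    have hxR : R ≤ q - k * (d + 1) := by
      refine Nat.le_of_mul_le_mul_left ?_ hp.pos
      have e1 : k * p * (d + 1) ≤ q * (d + 1) := Nat.mul_le_mul_right _ hkp.le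
      have e2 : q * (d + 2) ≤ q * τ := Nat.mul_le_mul_left q (by omega)
      zify [hkd] at *
      linarith
    have t₁ := truncCoeff_nonpos_of_le_left (p := p) (q := q) (τ := τ)
      (T := (p - 1 - (m + d + 1)) * q)
      (j := if m < m + d + 1 then m + d + 1 - 1 - m else p - 1 + (m + d + 1) - m) hxR
    have t₂ : 0 ≤ truncCoeff p q R τ ((p - 1 - (m + d + 1)) * q) (q - k * (d + 1))
        (p - 1 - m) := by
      refine truncCoeff_nonneg_of_lt ?_
      obtain ⟨g, hg⟩ : ∃ g, p - 1 - (m + d + 1) = g := ⟨_, rfl⟩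
      have e1 : k * p * (d + 1) < q * (d + 1) := Nat.mul_lt_mul_of_pos_right hkp (by omega)
      have e2 : p - 1 - m = g + (d + 1) := by omega
      rw [hg, e2]
      zify [hkd] at *
      linarith
    linarith
  · obtain ⟨d, rfl⟩ := Nat.exists_eq_add_of_le hms
    have hdm : U + d - U = d := by omega
    rw [wrapSeq_of_le hms, hdm, if_neg (by omega : ¬ U + d < U), if_pos ⟨hms, hm⟩]
    obtain ⟨e, he⟩ := Nat.exists_eq_add_of_lt hm
    have he' : p - 1 - U = d + e := by omega
    have t₁ : truncCoeff p q R τ ((p - 1 - U) * q) (k * d) (p - 1 + U - (U + d)) ≤ 0 := by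
      refine truncCoeff_nonpos_of_lt ?_
      have e1 : p - 1 + U - (U + d) = U + e := by omega
      have e2 : p - 1 - 2 * U + U = d + e := by omega
      have e3 : k * p * e ≤ q * e := Nat.mul_le_mul_right e hkp.le
      rw [he'] at hk₂
      rw [e1, he', ← e2]
      linarith
    have t₂ : truncCoeff p q R τ ((p - 1 - U) * q) (k * d) (p - 1 - (U + d)) = 1 := by
      refine truncCoeff_eq_one ?_ (by omega) ?_
      · refine Nat.lt_of_mul_lt_mul_left (a := p) ?_
        have e1 : q * (p - τ) + q * τ = p * q := by
          rw [← mul_add, Nat.sub_add_cancel hτ, mul_comm]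
        rw [he'] at hk₁
        have e2 : 0 ≤ k * p * e := Nat.zero_le _
        linarith
      · have e1 : p - 1 - (U + d) = e := by omega
        have e2 : k * p * d ≤ q * d := Nat.mul_le_mul_right d hkp.le
        rw [e1, he']
        linarith
    linarith

theorem modInv_spec {p b : ℕ} (hp : p.Prime) (hb : 1 ≤ b) (hbp : b < p) :
    1 ≤ modInv p b ∧ modInv p b < p ∧ b * modInv p b ≡ 1 [MOD p] := by
  have := Fact.mk hp
  have hb0 : (b : ZMod p) ≠ 0 := by
    rw [Ne, ZMod.natCast_eq_zero_iff]
    exact Nat.not_dvd_of_pos_of_lt hb hbp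
  refine ⟨Nat.one_le_iff_ne_zero.2 ?_, ZMod.val_lt _, ?_⟩
  · rw [modInv, Ne, ZMod.val_eq_zero]
    exact inv_ne_zero hb0
  · rw [← ZMod.natCast_eq_natCast_iff, modInv, Nat.cast_mul, ZMod.natCast_zmod_val, Nat.cast_one]
    exact mul_inv_cancel₀ hb0

theorem exists_prime_gt_modEq_of_mul_modEq_one {p τ U : ℕ} (hp : p.Prime) (hτ : 1 ≤ τ)
    (hτp : τ ≤ p) (hτU : τ * U ≡ 1 [MOD p]) (B : ℕ) :
    ∃ q R : ℕ, q.Prime ∧ B < q ∧ q ≡ U [MOD p] ∧ p * R + q * τ = p * q + 1 ∧ R ≤ q := by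
  have := Fact.mk hp
  have hτU' := (ZMod.natCast_eq_natCast_iff _ _ _).2 hτU
  push_cast at hτU'
  obtain ⟨q, hqB, hq, hqU⟩ :=
    Nat.forall_exists_prime_gt_and_eq_mod (IsUnit.of_mul_eq_one_right _ hτU') B
  have hqU' := (ZMod.natCast_eq_natCast_iff _ _ _).1 hqU
  have h1 : 1 ≡ q * τ [MOD p] := by
    rw [mul_comm]
    exact hτU.symm.trans (hqU'.mul_left τ).symm
  obtain ⟨z, hz⟩ := (Nat.modEq_iff_dvd' (Nat.mul_pos hq.pos hτ)).1 h1
  have hqτ : 1 ≤ q * τ := Nat.mul_pos hq.pos hτ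
  have hzq : p * z ≤ p * q := by
    rw [← hz]
    exact (Nat.sub_le _ _).trans (by rw [mul_comm p q]; exact Nat.mul_le_mul_left q hτp)
  refine ⟨q, q - z, hq, hqB, hqU', ?_, Nat.sub_le _ _⟩
  rw [Nat.mul_sub]
  omega

theorem natAbs_coeff_le_cycHeight (n k : ℕ) :
    ((Polynomial.cyclotomic n ℤ).coeff k).natAbs ≤ cycHeight n := by
  by_cases hk : k ≤ (Polynomial.cyclotomic n ℤ).natDegree
  · exact Finset.le_sup (f := fun k => ((Polynomial.cyclotomic n ℤ).coeff k).natAbs)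
      (Finset.mem_range.2 (by omega))
  · rw [Polynomial.coeff_eq_zero_of_natDegree_lt (by omega)]
    simp

theorem exists_sub_le_cycHeight_of_mem_Bminus {p β : ℕ} (hp : p.Prime) (hβ : β ∈ Bminus p) :
    ∃ q r : ℕ, q.Prime ∧ r.Prime ∧ p < q ∧ q < r ∧ p - β ≤ cycHeight (p * q * r) := by
  simp only [Bminus, Finset.mem_filter, Finset.mem_Icc] at hβ
  obtain ⟨⟨hβ1, -⟩, hβp, h1, h2⟩ := hβ
  obtain ⟨-, -, hinv⟩ := modInv_spec hp hβ1 (by omega)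
  set U := modInv p β
  obtain ⟨q, R, hq, hqB, hqU, hR, hRq⟩ :=
    exists_prime_gt_modEq_of_mul_modEq_one hp hβ1 (by omega) hinv (p * p * p)
  have hp0 := hp.pos
  have hpp : p ≤ p * p * p := by nlinarith
  have hD : 0 < p * (p - β) := Nat.mul_pos hp0 (by omega)
  obtain ⟨c, hc⟩ : ∃ c, p = β + c := ⟨p - β, by omega⟩
  have hcβ : p - β = c := by omega
  have hqβ : 1 ≤ q * β := Nat.mul_pos hq.pos hβ1
  set k := (q * β - 1) / (p * (p - β))
  have hk₁ : k * (p * (p - β)) ≤ q * β - 1 := Nat.div_mul_le_self _ _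
  have hk₂ : q * β - 1 < k * (p * (p - β)) + p * (p - β) := Nat.lt_div_mul_add hD
  have hkpos : 0 < k := by
    refine Nat.div_pos ?_ hD
    have : p * (p - β) ≤ p * p := Nat.mul_le_mul_left p (by omega)
    have : p * p ≤ p * p * p := Nat.le_mul_of_pos_right _ hp0
    have : q ≤ q * β := Nat.le_mul_of_pos_right _ hβ1
    omega
  rw [hcβ] at hk₁ hk₂
  rw [← mul_assoc] at hk₁ hk₂
  have hpc : p * c ≤ p * p := Nat.mul_le_mul_left p (by omega)
  have hkt : k * p + p * p < q := by
    by_contra! hcon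
    have e1 : q * c ≤ (k * p + p * p) * c := Nat.mul_le_mul_right c hcon
    have e2 : q * (β + 1) ≤ q * c := Nat.mul_le_mul_left q (by omega)
    have e3 : p * p * c ≤ p * p * p := Nat.mul_le_mul_left _ (by omega)
    have e4 : k * p * c < q * β := by omega
    linarith
  obtain ⟨r, n, hr, hqr, hn⟩ := exists_le_coeff_of_lt (t := p * p) hp hq (by omega) hR hRq h2
    (by omega) (by omega) hqU hkpos (by rw [hcβ]; omega) (by rw [hcβ]; omega) hkt
  refine ⟨q, r, hq, hr, by omega, hqr, le_trans ?_ (natAbs_coeff_le_cycHeight _ n)⟩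
  omega

theorem exists_sub_le_cycHeight_of_mem_Bplus {p β : ℕ} (hp : p.Prime) (hβ : β ∈ Bplus p) :
    ∃ q r : ℕ, q.Prime ∧ r.Prime ∧ p < q ∧ q < r ∧ p - β ≤ cycHeight (p * q * r) := by
  simp only [Bplus, Finset.mem_filter, Finset.mem_Icc] at hβ
  obtain ⟨⟨hβ1, -⟩, hβp, h1, h2⟩ := hβ
  obtain ⟨hτ1, hτp, hinv⟩ := modInv_spec hp hβ1 (by omega)
  rw [mul_comm] at hinv
  set τ := modInv p β
  obtain ⟨q, R, hq, hqB, hqU, hR, hRq⟩ :=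
    exists_prime_gt_modEq_of_mul_modEq_one hp hτ1 hτp.le hinv (p * p)
  have hp0 := hp.pos
  have hpp : p ≤ p * p := Nat.le_mul_of_pos_right _ hp0
  obtain ⟨c, hc⟩ : ∃ c, p - 1 - β = c := ⟨_, rfl⟩
  have hD : 0 < p * c := Nat.mul_pos hp0 (by omega)
  have hpc : p * c ≤ p * p := Nat.mul_le_mul_left p (by omega)
  set k := (q * (p - τ)) / (p * c)
  have hk₁ : k * (p * c) ≤ q * (p - τ) := Nat.div_mul_le_self _ _
  have hk₂ : q * (p - τ) < k * (p * c) + p * c := Nat.lt_div_mul_add hD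
  have hkpos : 0 < k := by
    refine Nat.div_pos ?_ hD
    have : q ≤ q * (p - τ) := Nat.le_mul_of_pos_right _ (by omega)
    omega
  rw [← mul_assoc] at hk₁ hk₂
  have hlt : q * (p - 1 - 2 * β) < k * p * c := by
    have e1 : q * (p - 1 - 2 * β + 1) ≤ q * (p - τ) := Nat.mul_le_mul_left q (by omega)
    rw [mul_add] at e1
    omega
  have hkp : k * p < q := by
    refine Nat.lt_of_mul_lt_mul_right (a := c) (hk₁.trans_lt ?_)
    exact Nat.mul_lt_mul_of_pos_left (by omega) hq.pos
  obtain ⟨r, n, hr, hqr, hn⟩ := exists_coeff_le_of_le_add hp hq (by omega) hR hRq hβp hτp.le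
    h1 hqU hkpos (by rw [hc]; exact hk₁) (by rw [hc]; exact hlt) hkp
  refine ⟨q, r, hq, hr, by omega, hqr, le_trans ?_ (natAbs_coeff_le_cycHeight _ n)⟩
  omega

theorem stmt_4 (p : ℕ) (hp : p.Prime) (hne : (Bset p).Nonempty) :
    (∃ q r : ℕ, q.Prime ∧ r.Prime ∧ p < q ∧ q < r ∧
      p - (Bset p).min' hne ≤ cycHeight (p * q * r)) ∧
    ((p : ℝ) + 1) / 2 < (p : ℝ) - ((Bset p).min' hne : ℝ) ∧
    ∃ q r : ℕ, q.Prime ∧ r.Prime ∧ p < q ∧ q < r ∧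
      ¬ ((cycHeight (p * q * r) : ℝ) ≤ ((p : ℝ) + 1) / 2) := by
  have hmem := Finset.min'_mem _ hne
  set β := (Bset p).min' hne
  have hβ : 2 * β + 3 ≤ p := by
    rcases Finset.mem_union.1 hmem with h | h
    · exact (Finset.mem_filter.1 h).2.1
    · exact (Finset.mem_filter.1 h).2.1
  have hβ' : (2 * β + 3 : ℝ) ≤ p := by exact_mod_cast hβ
  obtain ⟨q, r, hq, hr, hpq, hqr, hA⟩ : ∃ q r : ℕ, q.Prime ∧ r.Prime ∧ p < q ∧ q < r ∧
      p - β ≤ cycHeight (p * q * r) := by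
    rcases Finset.mem_union.1 hmem with h | h
    · exact exists_sub_le_cycHeight_of_mem_Bminus hp h
    · exact exists_sub_le_cycHeight_of_mem_Bplus hp h
  refine ⟨⟨q, r, hq, hr, hpq, hqr, hA⟩, by linarith, q, r, hq, hr, hpq, hqr, ?_⟩
  have hA' : (p : ℝ) ≤ cycHeight (p * q * r) + β := by
    exact_mod_cast Nat.sub_le_iff_le_add.1 hA
  rw [not_le]
  linarith
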